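/- arXiv:2205.11054 — 2 statements merged into one kernel-verified Lean document; each statement's English description precedes it below -/
import Mathlib

section
/- Let (T, F) be a pretorsion theory in a balanced category C (every morphism which is both a monomorphism and an epimorphism is an isomorphism). Then T is closed under quotients (if e : X → Y is an epimorphism and X ∈ T, then Y ∈ T) and F is closed under subobjects (if n : N → X is a monomorphism and X ∈ F, then N ∈ F). -/
/- Basic notions of pretorsion theories, after Borceux, Campanini, Gran,
"Pretorsion theories in lextensive categories". -/

namespace PretorsionPaper

open CategoryTheory CategoryTheory.Limits

universe w₂ w₁ v' u' v u

variable {C : Type u} [Category.{v} C]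

/-- A morphism is `Z`-trivial if it factors through an object of `Z`. -/
def IsTrivial (Z : Set C) {X Y : C} (f : X ⟶ Y) : Prop :=
  ∃ (W : C) (g : X ⟶ W) (h : W ⟶ Y), W ∈ Z ∧ g ≫ h = f

/-- `ε : K ⟶ A` is a `Z`-kernel of `f : A ⟶ B`. -/
structure IsZKernel (Z : Set C) {K A B : C} (ε : K ⟶ A) (f : A ⟶ B) : Prop where
  comp_trivial : IsTrivial Z (ε ≫ f)
  lift : ∀ {Y : C} (l : Y ⟶ A), IsTrivial Z (l ≫ f) → ∃! l' : Y ⟶ K, l' ≫ ε = l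

/-- `q : B ⟶ Q` is a `Z`-cokernel of `f : A ⟶ B`. -/
structure IsZCokernel (Z : Set C) {A B Q : C} (q : B ⟶ Q) (f : A ⟶ B) : Prop where
  comp_trivial : IsTrivial Z (f ≫ q)
  desc : ∀ {W : C} (h : B ⟶ W), IsTrivial Z (f ≫ h) → ∃! h' : Q ⟶ W, q ≫ h' = h

/-- A pretorsion theory `(T, F)` in a category `C`: two replete full subcategories
(given by their classes of objects) such that every morphism from `T` to `F` is
`Z`-trivial (`Z := T ∩ F`) and every object fits in a short `Z`-exact sequence
`T₀ ⟶ X ⟶ F₀` with `T₀ ∈ T`, `F₀ ∈ F`. -/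
structure PretorsionTheory (C : Type u) [Category.{v} C] where
  T : Set C
  F : Set C
  replete_T : ∀ {X Y : C}, (X ≅ Y) → X ∈ T → Y ∈ T
  replete_F : ∀ {X Y : C}, (X ≅ Y) → X ∈ F → Y ∈ F
  hom_trivial : ∀ {X Y : C}, X ∈ T → Y ∈ F → ∀ f : X ⟶ Y, IsTrivial (T ∩ F) f
  exact_seq : ∀ X : C, ∃ (T₀ F₀ : C) (e : T₀ ⟶ X) (h : X ⟶ F₀),
    T₀ ∈ T ∧ F₀ ∈ F ∧ IsZKernel (T ∩ F) e h ∧ IsZCokernel (T ∩ F) h e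

/-- The class of trivial objects of a pretorsion theory. -/
def PretorsionTheory.Z (P : PretorsionTheory C) : Set C := P.T ∩ P.F

theorem IsTrivial.precomp {Z : Set C} {X Y W : C} {f : X ⟶ Y} (hf : IsTrivial Z f) (g : W ⟶ X) :
    IsTrivial Z (g ≫ f) := by
  obtain ⟨V, a, b, hV, rfl⟩ := hf
  exact ⟨V, g ≫ a, b, hV, Category.assoc _ _ _⟩

theorem IsTrivial.postcomp {Z : Set C} {X Y W : C} {f : X ⟶ Y} (hf : IsTrivial Z f) (g : Y ⟶ W) :
    IsTrivial Z (f ≫ g) := by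
  obtain ⟨V, a, b, hV, rfl⟩ := hf
  exact ⟨V, a, b ≫ g, hV, (Category.assoc _ _ _).symm⟩

theorem IsZKernel.mono {Z : Set C} {K A B : C} {ε : K ⟶ A} {f : A ⟶ B} (h : IsZKernel Z ε f) :
    Mono ε where
  right_cancellation a b hab := by
    refine (h.lift (b ≫ ε) ?_).unique hab rfl
    simpa using h.comp_trivial.precomp b

theorem IsZCokernel.epi {Z : Set C} {A B Q : C} {q : B ⟶ Q} {f : A ⟶ B} (h : IsZCokernel Z q f) :
    Epi q where
  left_cancellation a b hab := by
    refine (h.desc (q ≫ b) ?_).unique hab rfl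
    simpa using h.comp_trivial.postcomp b

/-- in a balanced category, `T` is closed under quotients and
`F` is closed under subobjects. -/
theorem torsion_closed_quotients_torsionFree_closed_subobjects_of_balanced
    [Balanced C] (P : PretorsionTheory C) :
    (∀ {X Y : C} (e : X ⟶ Y), Epi e → X ∈ P.T → Y ∈ P.T) ∧
    (∀ {N X : C} (n : N ⟶ X), Mono n → X ∈ P.F → N ∈ P.F) := by
  constructor
  · intro X Y e _ hX
    obtain ⟨T₀, F₀, ε, h, hT, hF, hker, -⟩ := P.exact_seq Y
    obtain ⟨l, hl, -⟩ := hker.lift e (P.hom_trivial hX hF _)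
    have := hker.mono
    have : Epi ε := epi_of_epi_fac hl
    have := isIso_of_mono_of_epi ε
    exact P.replete_T (asIso ε) hT
  · intro N X n _ hX
    obtain ⟨T₀, F₀, ε, h, hT, hF, -, hcoker⟩ := P.exact_seq N
    obtain ⟨l, hl, -⟩ := hcoker.desc n (P.hom_trivial hT hX _)
    have := hcoker.epi
    have : Mono h := mono_of_mono_fac hl
    have := isIso_of_mono_of_epi h
    exact P.replete_F (asIso h).symm hF
end PretorsionPaper
end

section
/- Let (T, F) be a pretorsion theory in a lextensive category C and assume that T is closed under complemented subobjects (if X + Y ∈ T then X, Y ∈ T). Then the quotient functor Σ : C → Stab(C) is universal among finite-coproduct-preserving torsion theory functors: for every pointed category X with finite coproducts equipped with a torsion theory (T', F'), and every finite-coproduct-preserving torsion theory functor G : C → X, there exists a unique functor H : Stab(C) → X with H ∘ Σ = G; moreover this H preserves finite coproducts and is itself a torsion theory functor (with respect to the torsion theory on Stab(C) given by the full subcategories on the objects of T and of F, and the torsion theory (T', F') on X). -/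
/- Basic notions of pretorsion theories, after Borceux, Campanini, Gran,
"Pretorsion theories in lextensive categories". -/

namespace PretorsionPaper

open CategoryTheory CategoryTheory.Limits

universe w₂ w₁ v' u' v u

variable {C : Type u} [Category.{v} C]

/-- A morphism `β : B ⟶ Y` is a coproduct coprojection (equivalently, exhibits `B` as a
complemented subobject of `Y`) if there are `B'` and `β' : B' ⟶ Y` making `Y` a
coproduct of `B` and `B'` with coprojections `β`, `β'`. -/
def IsCoprodInclusion {B Y : C} (β : B ⟶ Y) : Prop :=
  ∃ (B' : C) (β' : B' ⟶ Y), Nonempty (IsColimit (BinaryCofan.mk β β'))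

/-- A representative of a partial morphism `X ⇀ Y`: a subobject-domain `dom` with an
inclusion `incl : dom ⟶ X` and a morphism `map : dom ⟶ Y`. -/
structure ParHom (X Y : C) where
  dom : C
  incl : dom ⟶ X
  map : dom ⟶ Y

/-- A partial morphism representative is valid when its inclusion is a complemented
subobject (a coproduct coprojection). -/
def ParHom.IsValid {X Y : C} (p : ParHom X Y) : Prop := IsCoprodInclusion p.incl

/-- The total partial morphism associated with an ordinary morphism (this is the
action of the functor `I : C ⟶ Par(C)`, and `Σ f` is its congruence class). -/
def ParHom.ofHom {X Y : C} (f : X ⟶ Y) : ParHom X Y := ⟨X, 𝟙 X, f⟩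

/-- Composition of partial morphism representatives, via the chosen pullback. -/
noncomputable def ParHom.comp [HasPullbacks C] {X Y W : C}
    (p : ParHom X Y) (q : ParHom Y W) : ParHom X W where
  dom := pullback p.map q.incl
  incl := pullback.fst p.map q.incl ≫ p.incl
  map := pullback.snd p.map q.incl ≫ q.map

/-- The zero partial morphism `X ⇀ Y`, factoring through the initial object. -/
noncomputable def ParHom.zero [HasInitial C] (X Y : C) : ParHom X Y :=
  ⟨⊥_ C, initial.to X, initial.to Y⟩

/-- The congruence relation on partial morphism representatives: there is a common
complemented subobject `Cm` of the two domains (with complements `C₁`, `C₂`),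
compatibly included in `X`, on which the two morphisms agree, and on the complements
the morphisms are `Z`-trivial. -/
def ParEquiv (Z : Set C) {X Y : C} (p q : ParHom X Y) : Prop :=
  ∃ (Cm C₁ C₂ : C) (γ₁ : Cm ⟶ p.dom) (δ₁ : C₁ ⟶ p.dom) (γ₂ : Cm ⟶ q.dom) (δ₂ : C₂ ⟶ q.dom),
    Nonempty (IsColimit (BinaryCofan.mk γ₁ δ₁)) ∧
    Nonempty (IsColimit (BinaryCofan.mk γ₂ δ₂)) ∧
    γ₁ ≫ p.incl = γ₂ ≫ q.incl ∧
    γ₁ ≫ p.map = γ₂ ≫ q.map ∧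
    IsTrivial Z (δ₁ ≫ p.map) ∧
    IsTrivial Z (δ₂ ≫ q.map)

section UniversalProperty

variable {D : Type u'} [Category.{v'} D]

/-- `k` is a kernel of `f` in a category with zero morphisms. -/
def IsKernelOf [HasZeroMorphisms D] {K A B : D} (k : K ⟶ A) (f : A ⟶ B) : Prop :=
  k ≫ f = 0 ∧ ∀ {N : D} (p : N ⟶ A), p ≫ f = 0 → ∃! u : N ⟶ K, u ≫ k = p

/-- `c` is a cokernel of `f` in a category with zero morphisms. -/
def IsCokernelOf [HasZeroMorphisms D] {A B Q : D} (c : B ⟶ Q) (f : A ⟶ B) : Prop :=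
  f ≫ c = 0 ∧ ∀ {W : D} (h : B ⟶ W), f ≫ h = 0 → ∃! u : Q ⟶ W, c ≫ u = h

/-- A (classical) torsion theory in a pointed category: a pair of replete full
subcategories such that every morphism from torsion to torsion-free is zero and every
object fits into a short exact sequence. -/
structure TorsionTheory (D : Type u') [Category.{v'} D] [HasZeroMorphisms D] where
  T : Set D
  F : Set D
  replete_T : ∀ {X Y : D}, (X ≅ Y) → X ∈ T → Y ∈ T
  replete_F : ∀ {X Y : D}, (X ≅ Y) → X ∈ F → Y ∈ F
  hom_zero : ∀ {X Y : D}, X ∈ T → Y ∈ F → ∀ f : X ⟶ Y, f = 0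
  exact_seq : ∀ X : D, ∃ (T₀ F₀ : D) (k : T₀ ⟶ X) (c : X ⟶ F₀),
    T₀ ∈ T ∧ F₀ ∈ F ∧ IsKernelOf k c ∧ IsCokernelOf c k

/-- A torsion theory functor from `(C, (T, F))` to `(D, Q)`: it sends torsion objects
to torsion objects, torsion-free objects to torsion-free objects, and each short
`Z`-exact sequence `T₀ ⟶ X ⟶ F₀` (with `T₀ ∈ T`, `F₀ ∈ F`) to a short exact
sequence. -/
def IsTorsionTheoryFunctor [HasZeroMorphisms D] (P : PretorsionTheory C)
    (Q : TorsionTheory D) (G : C ⥤ D) : Prop :=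
  (∀ X : C, X ∈ P.T → G.obj X ∈ Q.T) ∧ (∀ X : C, X ∈ P.F → G.obj X ∈ Q.F) ∧
  (∀ {T₀ X F₀ : C} (e : T₀ ⟶ X) (h : X ⟶ F₀), T₀ ∈ P.T → F₀ ∈ P.F →
    IsZKernel P.Z e h → IsZCokernel P.Z h e →
    IsKernelOf (G.map e) (G.map h) ∧ IsCokernelOf (G.map h) (G.map e))

/-- A functor defined on the stable category `Stab(C)`, described concretely: an
assignment on objects of `C` and on (valid) partial morphism representatives, which
is constant on congruence classes and functorial. -/
structure StabFunctor (Z : Set C) [HasPullbacks C] (D : Type u') [Category.{v'} D] where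
  obj : C → D
  map : ∀ {A B : C} (p : ParHom A B), p.IsValid → (obj A ⟶ obj B)
  map_congr : ∀ {A B : C} (p q : ParHom A B) (hp : p.IsValid) (hq : q.IsValid),
    ParEquiv Z p q → map p hp = map q hq
  map_id : ∀ (A : C) (h : (ParHom.ofHom (𝟙 A)).IsValid),
    map (ParHom.ofHom (𝟙 A)) h = 𝟙 (obj A)
  map_comp : ∀ {A B E : C} (p : ParHom A B) (q : ParHom B E)
    (hp : p.IsValid) (hq : q.IsValid) (hpq : (p.comp q).IsValid),
    map (p.comp q) hpq = map p hp ≫ map q hq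

/-- `H : Stab(C) ⟶ D` satisfies `H ∘ Σ = G`. -/
def ExtendsAlongSigma [HasPullbacks C] (Z : Set C) (G : C ⥤ D) (H : StabFunctor Z D) :
    Prop :=
  ∃ e : ∀ A : C, H.obj A = G.obj A,
    ∀ {A B : C} (f : A ⟶ B) (h : (ParHom.ofHom f).IsValid),
      H.map (ParHom.ofHom f) h = eqToHom (e A) ≫ G.map f ≫ eqToHom (e B).symm

/-- A functor on the stable category preserves finite coproducts: it sends the zero
object `Σ 0` to an initial object and the images of coproduct coprojections to
coproduct diagrams. -/
def StabPreservesFiniteCoproducts [HasPullbacks C] [HasInitial C] [HasBinaryCoproducts C]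
    (Z : Set C) (H : StabFunctor Z D) : Prop :=
  Nonempty (IsInitial (H.obj (⊥_ C))) ∧
  ∀ (X Y : C) (h₁ : (ParHom.ofHom (coprod.inl : X ⟶ X ⨿ Y)).IsValid)
    (h₂ : (ParHom.ofHom (coprod.inr : Y ⟶ X ⨿ Y)).IsValid),
    Nonempty (IsColimit (BinaryCofan.mk
      (H.map (ParHom.ofHom (coprod.inl : X ⟶ X ⨿ Y)) h₁)
      (H.map (ParHom.ofHom (coprod.inr : Y ⟶ X ⨿ Y)) h₂)))

/-- A functor on the stable category is a torsion theory functor (with respect to the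
torsion theory induced by `(T, F)` on `Stab(C)` and the torsion theory `Q` on `D`). -/
def StabIsTorsionTheoryFunctor [HasPullbacks C] [HasZeroMorphisms D]
    (P : PretorsionTheory C) (Q : TorsionTheory D) (H : StabFunctor P.Z D) : Prop :=
  (∀ X : C, X ∈ P.T → H.obj X ∈ Q.T) ∧ (∀ X : C, X ∈ P.F → H.obj X ∈ Q.F) ∧
  (∀ {T₀ X F₀ : C} (e : T₀ ⟶ X) (h : X ⟶ F₀), T₀ ∈ P.T → F₀ ∈ P.F →
    IsZKernel P.Z e h → IsZCokernel P.Z h e →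
    ∀ (he : (ParHom.ofHom e).IsValid) (hh : (ParHom.ofHom h).IsValid),
      IsKernelOf (H.map (ParHom.ofHom e) he) (H.map (ParHom.ofHom h) hh) ∧
      IsCokernelOf (H.map (ParHom.ofHom h) hh) (H.map (ParHom.ofHom e) he))

section Coproducts

/-- `α` and `β` exhibit their codomain as a coproduct. -/
def IsCoprod {A B X : C} (α : A ⟶ X) (β : B ⟶ X) : Prop :=
  Nonempty (IsColimit (BinaryCofan.mk α β))

theorem IsCoprod.hom_ext {A B X Y : C} {α : A ⟶ X} {β : B ⟶ X} (h : IsCoprod α β)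
    {f g : X ⟶ Y} (h₁ : α ≫ f = α ≫ g) (h₂ : β ≫ f = β ≫ g) : f = g :=
  BinaryCofan.IsColimit.hom_ext h.some h₁ h₂

theorem IsCoprod.exists_desc {A B X Y : C} {α : A ⟶ X} {β : B ⟶ X} (h : IsCoprod α β)
    (f : A ⟶ Y) (g : B ⟶ Y) : ∃ k : X ⟶ Y, α ≫ k = f ∧ β ≫ k = g :=
  ⟨_, (BinaryCofan.IsColimit.desc' h.some f g).2⟩

theorem IsCoprod.map {A B X : C} {α : A ⟶ X} {β : B ⟶ X} (h : IsCoprod α β)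
    (G : C ⥤ D) [PreservesFiniteCoproducts G] : IsCoprod (G.map α) (G.map β) :=
  ⟨mapIsColimitOfPreservesOfIsColimit G α β h.some⟩

theorem isCoprod_of_isIso [HasInitial C] {A X : C} (α : A ⟶ X) [IsIso α] :
    IsCoprod α (initial.to X) :=
  ⟨((BinaryCofan.isColimit_iff_isIso_inl initialIsInitial (BinaryCofan.mk α (initial.to X))).mpr
    (inferInstanceAs (IsIso α))).some⟩

theorem isCoprod_initial_left [HasInitial C] {A X : C} (α : A ⟶ X) [IsIso α] :
    IsCoprod (initial.to X) α :=
  ⟨((BinaryCofan.isColimit_iff_isIso_inr initialIsInitial (BinaryCofan.mk (initial.to X) α)).mpr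
    (inferInstanceAs (IsIso α))).some⟩

theorem isCoprodInclusion_of_isIso [HasInitial C] {A X : C} (α : A ⟶ X) [IsIso α] :
    IsCoprodInclusion α :=
  ⟨_, _, isCoprod_of_isIso α⟩

theorem isCoprodInclusion_initial_to [HasInitial C] (X : C) :
    IsCoprodInclusion (initial.to X) :=
  ⟨_, _, isCoprod_initial_left (𝟙 X)⟩

theorem IsCoprodInclusion.comp [HasBinaryCoproducts C] {A B X : C} {α : A ⟶ B} {β : B ⟶ X}
    (hα : IsCoprodInclusion α) (hβ : IsCoprodInclusion β) : IsCoprodInclusion (α ≫ β) := by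
  obtain ⟨A', α', h⟩ := hα
  obtain ⟨B', β', h'⟩ := hβ
  change IsCoprod _ _ at h h'
  refine ⟨A' ⨿ B', coprod.desc (α' ≫ β) β', ?_⟩
  choose u hu₁ hu₂ using fun s : BinaryCofan A (A' ⨿ B') =>
    h.exists_desc s.inl (coprod.inl ≫ s.inr)
  choose k hk₁ hk₂ using fun s => h'.exists_desc (u s) (coprod.inr ≫ s.inr)
  refine ⟨BinaryCofan.isColimitMk k ?_ ?_ ?_⟩
  · intro s
    rw [Category.assoc, hk₁, hu₁]
  · intro s
    ext
    · rw [coprod.inl_desc_assoc, Category.assoc, hk₁, hu₂]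
    · rw [coprod.inr_desc_assoc, hk₂]
  · intro s m h₁ h₂
    refine h'.hom_ext (h.hom_ext ?_ ?_) ?_
    · rw [← Category.assoc, h₁, hk₁, hu₁]
    · rw [hk₁, hu₂, ← h₂, coprod.inl_desc_assoc, Category.assoc]
    · rw [hk₂, ← h₂, coprod.inr_desc_assoc]

variable [FinitaryExtensive C]

theorem IsCoprod.mono_left {A B X : C} {α : A ⟶ X} {β : B ⟶ X} (h : IsCoprod α β) : Mono α :=
  FinitaryExtensive.mono_inl_of_isColimit h.some

theorem IsCoprodInclusion.mono {A X : C} {α : A ⟶ X} (h : IsCoprodInclusion α) : Mono α := by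
  obtain ⟨_, _, h⟩ := h
  exact IsCoprod.mono_left h

/-- The coprojections of a coproduct are disjoint. -/
theorem IsCoprod.disjoint {A B X E : C} {α : A ⟶ X} {β : B ⟶ X} (h : IsCoprod α β)
    {a : E ⟶ A} {b : E ⟶ B} (w : a ≫ α = b ≫ β) : Nonempty (E ⟶ ⊥_ C) :=
  ⟨(FinitaryExtensive.isPullback_initial_to_binaryCofan h.some).lift a b w⟩

/-- Coproduct decompositions are stable under pullback. -/
theorem IsCoprod.pullback [HasPullbacks C] {A B X E : C} {α : A ⟶ X} {β : B ⟶ X}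
    (h : IsCoprod α β) (g : E ⟶ X) :
    IsCoprod (pullback.fst g α) (pullback.fst g β) :=
  ((BinaryCofan.isVanKampen_iff _).mp (FinitaryExtensive.vanKampen _ h.some)
    (BinaryCofan.mk (pullback.fst g α) (pullback.fst g β)) (pullback.snd g α) (pullback.snd g β) g
    pullback.condition.symm pullback.condition.symm).mpr
    ⟨IsPullback.of_hasPullback g α, IsPullback.of_hasPullback g β⟩

theorem IsCoprodInclusion.pullback_fst [HasPullbacks C] {A X E : C} {α : A ⟶ X}
    (h : IsCoprodInclusion α) (g : E ⟶ X) : IsCoprodInclusion (pullback.fst g α) := by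
  obtain ⟨_, _, h⟩ := h
  exact ⟨_, _, IsCoprod.pullback h g⟩

end Coproducts

section PartialMorphisms

theorem ParHom.isValid_ofHom [HasInitial C] {X Y : C} (f : X ⟶ Y) : (ParHom.ofHom f).IsValid :=
  isCoprodInclusion_of_isIso (𝟙 X)

theorem ParHom.IsValid.comp [FinitaryExtensive C] [HasPullbacks C] {X Y W : C}
    {p : ParHom X Y} {q : ParHom Y W} (hp : p.IsValid) (hq : q.IsValid) : (p.comp q).IsValid :=
  IsCoprodInclusion.comp (IsCoprodInclusion.pullback_fst hq p.map) hp

theorem IsTrivial.comp_left {Z : Set C} {X Y W : C} {g : Y ⟶ W} (hg : IsTrivial Z g)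
    (f : X ⟶ Y) : IsTrivial Z (f ≫ g) := by
  obtain ⟨V, a, b, hV, rfl⟩ := hg
  exact ⟨V, f ≫ a, b, hV, Category.assoc _ _ _⟩

/-- Two partial morphisms whose total parts are trivial are congruent. -/
theorem ParEquiv.of_isTrivial [HasInitial C] {Z : Set C} {X Y : C} {p q : ParHom X Y}
    (hp : IsTrivial Z p.map) (hq : IsTrivial Z q.map) : ParEquiv Z p q :=
  ⟨⊥_ C, p.dom, q.dom, initial.to _, 𝟙 _, initial.to _, 𝟙 _, isCoprod_initial_left _,
    isCoprod_initial_left _, initialIsInitial.hom_ext _ _, initialIsInitial.hom_ext _ _,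
    hp.comp_left _, hq.comp_left _⟩

/-- Isomorphic partial morphisms are congruent, provided that the morphism from the initial object
to the target is trivial. -/
theorem ParEquiv.of_iso [HasInitial C] {Z : Set C} {X Y : C} {p q : ParHom X Y}
    (hY : IsTrivial Z (initial.to Y)) (i : p.dom ⟶ q.dom) [IsIso i]
    (h₁ : p.incl = i ≫ q.incl) (h₂ : p.map = i ≫ q.map) : ParEquiv Z p q :=
  ⟨p.dom, ⊥_ C, ⊥_ C, 𝟙 _, initial.to _, i, initial.to _, isCoprod_of_isIso _,
    isCoprod_of_isIso _, by rw [Category.id_comp, h₁], by rw [Category.id_comp, h₂],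
    by rwa [initialIsInitial.hom_ext (initial.to _ ≫ p.map) (initial.to Y)],
    by rwa [initialIsInitial.hom_ext (initial.to _ ≫ q.map) (initial.to Y)]⟩

theorem PretorsionTheory.nonempty_Z (P : PretorsionTheory C) (X : C) : P.Z.Nonempty := by
  obtain ⟨_, _, e, h, _, _, he, _⟩ := P.exact_seq X
  obtain ⟨W, _, _, hW, _⟩ := he.comp_trivial
  exact ⟨W, hW⟩

end PartialMorphisms

section Extension

variable [HasZeroMorphisms D]

theorem isZero_map_initial [HasInitial C] (G : C ⥤ D) [PreservesFiniteCoproducts G] :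
    IsZero (G.obj (⊥_ C)) :=
  (IsZero.iff_id_eq_zero _).mpr
    ((IsInitial.isInitialObj G _ initialIsInitial).hom_ext _ _)

theorem map_eq_zero_of_hom_initial [HasInitial C] (G : C ⥤ D) [PreservesFiniteCoproducts G]
    {E : C} (a : E ⟶ ⊥_ C) [HasStrictInitialObjects C] {Y : D} (f : G.obj E ⟶ Y) : f = 0 := by
  have := initialIsInitial.isIso_to a
  exact ((isZero_map_initial G).of_iso (G.mapIso (asIso a))).eq_of_src _ _

theorem IsTorsionTheoryFunctor.isZero_obj {P : PretorsionTheory C} {Q : TorsionTheory D}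
    {G : C ⥤ D} (hG : IsTorsionTheoryFunctor P Q G) {W : C} (hW : W ∈ P.Z) :
    IsZero (G.obj W) :=
  (IsZero.iff_id_eq_zero _).mpr (Q.hom_zero (hG.1 W hW.1) (hG.2.1 W hW.2) _)

theorem IsTorsionTheoryFunctor.map_eq_zero {P : PretorsionTheory C} {Q : TorsionTheory D}
    {G : C ⥤ D} (hG : IsTorsionTheoryFunctor P Q G) {X Y : C} {f : X ⟶ Y}
    (hf : IsTrivial P.Z f) : G.map f = 0 := by
  obtain ⟨W, g, h, hW, rfl⟩ := hf
  rw [G.map_comp, (hG.isZero_obj hW).eq_of_tgt (G.map g) 0, zero_comp]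

variable (G : C ⥤ D) [PreservesFiniteCoproducts G]

theorem exists_extend {X Y : C} (p : ParHom X Y) (hp : p.IsValid) :
    ∃ k : G.obj X ⟶ G.obj Y, G.map p.incl ≫ k = G.map p.map ∧
      ∃ (B : C) (β : B ⟶ X), IsCoprod p.incl β ∧ G.map β ≫ k = 0 := by
  obtain ⟨B, β, h⟩ := hp
  obtain ⟨k, hk₁, hk₂⟩ := (IsCoprod.map h G).exists_desc (G.map p.map) (0 : G.obj B ⟶ G.obj Y)
  exact ⟨k, hk₁, B, β, h, hk₂⟩

/-- The image of a partial morphism under the extension of `G`: it is `G.map p.map` on the domain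
of `p` and zero on a complement of this domain. -/
noncomputable def extend {X Y : C} (p : ParHom X Y) (hp : p.IsValid) : G.obj X ⟶ G.obj Y :=
  (exists_extend G p hp).choose

theorem map_incl_extend {X Y : C} (p : ParHom X Y) (hp : p.IsValid) :
    G.map p.incl ≫ extend G p hp = G.map p.map :=
  (exists_extend G p hp).choose_spec.1

theorem extend_ofHom {X Y : C} (f : X ⟶ Y) (h : (ParHom.ofHom f).IsValid) :
    extend G (ParHom.ofHom f) h = G.map f := by
  simpa [ParHom.ofHom] using map_incl_extend G (ParHom.ofHom f) h

variable [FinitaryExtensive C]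

/-- The extension vanishes on every morphism which is disjoint from the domain. -/
theorem map_extend_eq_zero [HasPullbacks C] {X Y E : C} (p : ParHom X Y) (hp : p.IsValid)
    (δ : E ⟶ X) (h : ∀ {S : C} (a : S ⟶ E) (b : S ⟶ p.dom), a ≫ δ = b ≫ p.incl →
      Nonempty (S ⟶ ⊥_ C)) :
    G.map δ ≫ extend G p hp = 0 := by
  obtain ⟨B, β, hc, hβ⟩ := (exists_extend G p hp).choose_spec.2
  refine ((hc.pullback δ).map G).hom_ext ?_ ?_
  · obtain ⟨t⟩ := h _ _ (pullback.condition (f := δ) (g := p.incl))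
    exact (map_eq_zero_of_hom_initial G t _).trans (map_eq_zero_of_hom_initial G t _).symm
  · rw [← G.map_comp_assoc, pullback.condition, G.map_comp_assoc, extend, hβ, comp_zero,
      comp_zero]

theorem IsCoprod.map_extend_eq_zero [HasPullbacks C] {X Y E : C} {p : ParHom X Y}
    (hp : p.IsValid) {β : E ⟶ X} (h : IsCoprod p.incl β) : G.map β ≫ extend G p hp = 0 :=
  PretorsionPaper.map_extend_eq_zero G p hp β fun _ _ w => h.disjoint w.symm

theorem extend_comp [HasPullbacks C] {X Y W : C} (p : ParHom X Y) (q : ParHom Y W)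
    (hp : p.IsValid) (hq : q.IsValid) (hpq : (p.comp q).IsValid) :
    extend G (p.comp q) hpq = extend G p hp ≫ extend G q hq := by
  obtain ⟨B, β, h⟩ := id hp
  obtain ⟨E, ε, h'⟩ := id hq
  change IsCoprod _ _ at h h'
  have := h.mono_left
  refine (h.map G).hom_ext (((h'.pullback p.map).map G).hom_ext ?_ ?_) ?_
  · have h₀ : G.map (pullback.fst p.map q.incl ≫ p.incl) ≫ extend G (p.comp q) hpq =
        G.map (pullback.snd p.map q.incl ≫ q.map) := map_incl_extend G (p.comp q) hpq
    rw [G.map_comp_assoc, G.map_comp] at h₀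
    rw [h₀, ← Category.assoc (G.map p.incl), map_incl_extend, ← G.map_comp_assoc,
      pullback.condition, G.map_comp_assoc, map_incl_extend]
  · rw [← Category.assoc (G.map p.incl), map_incl_extend, ← G.map_comp_assoc (_) p.map,
      pullback.condition, G.map_comp_assoc, h'.map_extend_eq_zero G hq, comp_zero,
      ← G.map_comp_assoc]
    refine map_extend_eq_zero G _ _ _ fun {S} a b w => ?_
    dsimp only [ParHom.comp] at b w
    rw [← Category.assoc, ← Category.assoc, cancel_mono] at w
    exact (h'.pullback p.map).disjoint w.symm
  · rw [← Category.assoc, h.map_extend_eq_zero G hp, zero_comp]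
    refine map_extend_eq_zero G _ _ _ fun {S} a b w => ?_
    dsimp only [ParHom.comp] at b w
    rw [← Category.assoc] at w
    exact h.disjoint w.symm

variable {G} {P : PretorsionTheory C} {Q : TorsionTheory D}

/-- Restricting a partial morphism along a complemented subobject on whose complement it is
trivial does not change its extension. -/
theorem extend_restrict [HasPullbacks C] (hG : IsTorsionTheoryFunctor P Q G) {X Y A B : C}
    (p : ParHom X Y) (hp : p.IsValid) {γ : A ⟶ p.dom} {δ : B ⟶ p.dom} (h : IsCoprod γ δ)
    (hδ : IsTrivial P.Z (δ ≫ p.map)) (hr : (ParHom.mk A (γ ≫ p.incl) (γ ≫ p.map)).IsValid) :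
    extend G p hp = extend G (ParHom.mk A (γ ≫ p.incl) (γ ≫ p.map)) hr := by
  obtain ⟨E, ε, h'⟩ := id hp
  change IsCoprod _ _ at h'
  have := h'.mono_left
  refine (h'.map G).hom_ext ((h.map G).hom_ext ?_ ?_) ?_
  · have := map_incl_extend G _ hr
    dsimp only at this
    rw [map_incl_extend, ← G.map_comp_assoc, this, G.map_comp]
  · rw [map_incl_extend, ← G.map_comp, hG.map_eq_zero hδ, ← G.map_comp_assoc]
    refine (map_extend_eq_zero G _ _ _ fun {S} a b w => ?_).symm
    dsimp only at b w
    rw [← Category.assoc, ← Category.assoc, cancel_mono] at w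
    exact h.disjoint w.symm
  · rw [h'.map_extend_eq_zero G hp]
    refine (map_extend_eq_zero G _ _ _ fun {S} a b w => ?_).symm
    dsimp only at b w
    rw [← Category.assoc] at w
    exact h'.disjoint w.symm

theorem extend_congr [HasPullbacks C] (hG : IsTorsionTheoryFunctor P Q G) {X Y : C}
    (p q : ParHom X Y) (hp : p.IsValid) (hq : q.IsValid) (h : ParEquiv P.Z p q) :
    extend G p hp = extend G q hq := by
  obtain ⟨A, B₁, B₂, γ₁, δ₁, γ₂, δ₂, h₁, h₂, hi, hm, ht₁, ht₂⟩ := h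
  rw [extend_restrict hG p hp h₁ ht₁ (IsCoprodInclusion.comp ⟨_, _, h₁⟩ hp),
    extend_restrict hG q hq h₂ ht₂ (IsCoprodInclusion.comp ⟨_, _, h₂⟩ hq)]
  congr 2

/-- The functor on the stable category extending `G`. -/
noncomputable def stabExtension [HasPullbacks C] (hG : IsTorsionTheoryFunctor P Q G) :
    StabFunctor P.Z D where
  obj := G.obj
  map p hp := extend G p hp
  map_congr := extend_congr hG
  map_id A h := by rw [extend_ofHom, G.map_id]
  map_comp := extend_comp G

end Extension

section Uniqueness

variable [HasPullbacks C] {Z : Set C} {G : C ⥤ D} {H : StabFunctor Z D}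

/-- The composite of a functor on the stable category with the quotient functor preserves
composition. This is not automatic, since the congruence may fail to be reflexive when the initial
object is not trivial. -/
def StabFunctor.IsCompatible [HasInitial C] (H : StabFunctor Z D) : Prop :=
  ∀ {X Y W : C} (f : X ⟶ Y) (g : Y ⟶ W),
    H.map (ParHom.ofHom (f ≫ g)) (ParHom.isValid_ofHom _) =
      H.map (ParHom.ofHom f) (ParHom.isValid_ofHom f) ≫
        H.map (ParHom.ofHom g) (ParHom.isValid_ofHom g)

/-- The composite of a functor on the stable category with the quotient functor. -/
abbrev StabFunctor.IsCompatible.functor [HasInitial C] (h : H.IsCompatible) : C ⥤ D where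
  obj := H.obj
  map f := H.map (ParHom.ofHom f) (ParHom.isValid_ofHom f)
  map_id A := H.map_id A _
  map_comp := h

theorem ExtendsAlongSigma.exists_functor_eq [HasInitial C] (h : ExtendsAlongSigma Z G H) :
    ∃ h' : H.IsCompatible, h'.functor = G := by
  obtain ⟨e, he⟩ := h
  exact ⟨fun f g => by simp [he],
    CategoryTheory.Functor.ext e fun _ _ f => he f (ParHom.isValid_ofHom f)⟩

variable [FinitaryExtensive C] [HasZeroMorphisms D]

/-- A functor on the stable category is determined by its restriction to `C`, on partial morphisms
to an object for which the morphism from the initial object is trivial. -/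
theorem StabFunctor.IsCompatible.map_eq_extend_of_isTrivial (h : H.IsCompatible)
    [PreservesFiniteCoproducts h.functor] {X Y : C} (hY : IsTrivial Z (initial.to Y))
    (p : ParHom X Y) (hp : p.IsValid) : H.map p hp = extend h.functor p hp := by
  obtain ⟨B, β, hc⟩ := id hp
  change IsCoprod _ _ at hc
  have := hc.mono_left
  refine (hc.map h.functor).hom_ext ?_ ?_
  · rw [map_incl_extend]
    refine (H.map_comp _ _ (ParHom.isValid_ofHom p.incl) hp
      ((ParHom.isValid_ofHom _).comp hp)).symm.trans (H.map_congr _ _ _ _ ?_)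
    let i : ((ParHom.ofHom p.incl).comp p).dom ⟶ (ParHom.ofHom p.map).dom :=
      pullback.fst p.incl p.incl
    have : IsIso i := isIso_fst_of_mono p.incl
    refine ParEquiv.of_iso hY i rfl ?_
    change pullback.snd p.incl p.incl ≫ p.map = pullback.fst p.incl p.incl ≫ p.map
    rw [fst_eq_snd_of_mono_eq]
  · rw [hc.map_extend_eq_zero h.functor hp]
    let z : ParHom B (⊥_ C) := ⟨⊥_ C, initial.to B, 𝟙 _⟩
    have hz : z.IsValid := isCoprodInclusion_initial_to B
    have h₀ := ParHom.isValid_ofHom (initial.to Y)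
    refine (H.map_comp _ _ (ParHom.isValid_ofHom β) hp
      ((ParHom.isValid_ofHom _).comp hp)).symm.trans
      ((H.map_congr _ (z.comp (ParHom.ofHom (initial.to Y))) _ (hz.comp h₀) ?_).trans
        ((H.map_comp _ _ hz h₀ _).trans ?_))
    · refine ParEquiv.of_isTrivial ?_ (hY.comp_left _)
      obtain ⟨t⟩ := hc.disjoint (pullback.condition (f := β) (g := p.incl)).symm
      have := initialIsInitial.isIso_to t
      have e : pullback.snd β p.incl ≫ p.map = t ≫ initial.to Y := by
        rw [← cancel_epi (inv t)]
        exact initialIsInitial.hom_ext _ _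
      change IsTrivial Z (pullback.snd β p.incl ≫ p.map)
      rw [e]
      exact hY.comp_left t
    · exact (congrArg (· ≫ _) ((isZero_map_initial h.functor).eq_of_tgt _ 0)).trans zero_comp

theorem StabFunctor.IsCompatible.map_eq_extend (hZ : Z.Nonempty) (h : H.IsCompatible)
    [PreservesFiniteCoproducts h.functor] {X Y : C} (p : ParHom X Y) (hp : p.IsValid) :
    H.map p hp = extend h.functor p hp := by
  obtain ⟨W, hW⟩ := hZ
  have hY : IsTrivial Z (initial.to (Y ⨿ W)) :=
    ⟨W, initial.to W, coprod.inr, hW, initialIsInitial.hom_ext _ _⟩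
  have hi := ParHom.isValid_ofHom (coprod.inl : Y ⟶ Y ⨿ W)
  have hc : IsCoprod (coprod.inl : Y ⟶ Y ⨿ W) coprod.inr := ⟨coprodIsCoprod Y W⟩
  obtain ⟨r, hr, -⟩ := (hc.map h.functor).exists_desc (𝟙 (h.functor.obj Y)) 0
  have : Mono (h.functor.map (coprod.inl : Y ⟶ Y ⨿ W)) :=
    mono_of_mono_fac hr
  have key : H.map p hp ≫ h.functor.map (coprod.inl : Y ⟶ Y ⨿ W) =
      extend h.functor p hp ≫ h.functor.map coprod.inl :=
    calc
      _ = H.map (p.comp (ParHom.ofHom coprod.inl)) (hp.comp hi) := (H.map_comp p _ hp hi _).symm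
      _ = extend h.functor p hp ≫ extend h.functor (ParHom.ofHom coprod.inl) hi :=
        (h.map_eq_extend_of_isTrivial hY _ _).trans (extend_comp _ _ _ _ _ _)
      _ = _ := by rw [extend_ofHom]
  exact (cancel_mono (h.functor.map (coprod.inl : Y ⟶ Y ⨿ W))).mp key

end Uniqueness

/-- universal property of the stable category.  If `T` is closed under
complemented subobjects, then for every pointed category `D` with finite coproducts
equipped with a torsion theory `Q` and every finite-coproduct-preserving torsion
theory functor `G : C ⥤ D`, there is a unique functor `H : Stab(C) ⟶ D` with
`H ∘ Σ = G`; moreover any such `H` preserves finite coproducts and is a torsion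
theory functor. -/
theorem stable_category_universal_property
    [FinitaryExtensive C] [HasFiniteLimits C] (P : PretorsionTheory C)
    (hT : ∀ X Y : C, (X ⨿ Y) ∈ P.T → X ∈ P.T ∧ Y ∈ P.T)
    [HasZeroObject D] [HasZeroMorphisms D] [HasFiniteCoproducts D]
    (Q : TorsionTheory D) (G : C ⥤ D)
    (hG : IsTorsionTheoryFunctor P Q G) (hGc : PreservesFiniteCoproducts G) :
    (∃! H : StabFunctor P.Z D, ExtendsAlongSigma P.Z G H) ∧
    (∀ H : StabFunctor P.Z D, ExtendsAlongSigma P.Z G H →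
      StabPreservesFiniteCoproducts P.Z H ∧ StabIsTorsionTheoryFunctor P Q H) := by
  refine ⟨⟨stabExtension hG, ⟨fun _ => rfl, fun f h => ?_⟩,
    fun H h => ?_⟩, fun H h => ?_⟩
  · change extend G _ h = 𝟙 _ ≫ G.map f ≫ 𝟙 _
    rw [extend_ofHom, Category.id_comp, Category.comp_id]
  · obtain ⟨h', rfl⟩ := h.exists_functor_eq
    obtain ⟨obj, map, _, _, _⟩ := H
    unfold stabExtension
    congr 1
    funext A B p hp
    exact h'.map_eq_extend (P.nonempty_Z A) p hp
  · obtain ⟨h', rfl⟩ := h.exists_functor_eq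
    exact ⟨⟨⟨IsInitial.isInitialObj h'.functor _ initialIsInitial⟩, fun X Y _ _ =>
      IsCoprod.map ⟨coprodIsCoprod X Y⟩ h'.functor⟩, hG.1, hG.2.1,
      fun e f he hf hk hc _ _ => hG.2.2 e f he hf hk hc⟩

end UniversalProperty
end PretorsionPaper
end
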